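/- arXiv:1111.2755 — 9 statements merged into one kernel-verified Lean document; each statement's English description precedes it below -/
import Mathlib

section
/- Let χ > 0 and let M be the quadratic form on Fin 4 → ℝ given by M(x,x) := χ·((x 0)² − (x 1)² + (x 2)² + (x 3)²) (the canonical form of the energy tensor of a non null electromagnetic field with proper energy density χ, whose time-like principal plane is spanned by the directions 0 and 1). Then for every observer x (η(x,x) = −1) one has M(x,x) = χ·(1 + 2(x 2)² + 2(x 3)²) ≥ χ, with equality if and only if x 2 = 0 and x 3 = 0, i.e. if and only if x lies in the time-like principal plane. -/
/-- The Minkowski inner product on `Fin 4 → ℝ` with signature `(-,+,+,+)`. -/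
def eta (x y : Fin 4 → ℝ) : ℝ :=
  -(x 0 * y 0) + x 1 * y 1 + x 2 * y 2 + x 3 * y 3

/-- For a non null electromagnetic field with canonical energy tensor
`M = χ · diag(1,-1,1,1)` (proper energy density `χ > 0`, time-like principal plane
spanned by directions 0 and 1), every observer `x` measures energy density
`M(x,x) = χ(1 + 2(x 2)² + 2(x 3)²) ≥ χ`, with equality exactly for the observers
at rest, i.e. those lying in the time-like principal plane. -/
theorem em_nonnull_min_energy_density
    (χ : ℝ) (hχ : 0 < χ) (x : Fin 4 → ℝ) (hx : eta x x = -1)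
    (M : ℝ) (hM : M = χ * ((x 0) ^ 2 - (x 1) ^ 2 + (x 2) ^ 2 + (x 3) ^ 2)) :
    M = χ * (1 + 2 * (x 2) ^ 2 + 2 * (x 3) ^ 2) ∧
    M ≥ χ ∧
    (M = χ ↔ (x 2 = 0 ∧ x 3 = 0)) := by
  have hM' : M = χ * (1 + 2 * (x 2) ^ 2 + 2 * (x 3) ^ 2) := by
    unfold eta at hx
    linear_combination hM - χ * hx
  refine ⟨hM', ?_, fun h => ?_, ?_⟩
  · nlinarith [mul_nonneg hχ.le (sq_nonneg (x 2)), mul_nonneg hχ.le (sq_nonneg (x 3))]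
  · have hsum : (x 2) ^ 2 + (x 3) ^ 2 = 0 := by
      apply mul_left_cancel₀ hχ.ne'
      linear_combination (h - hM') / 2
    constructor <;> nlinarith [sq_nonneg (x 2), sq_nonneg (x 3)]
  · rintro ⟨h2, h3⟩
    simp [hM', h2, h3]
end

section
/- Let χ > 0 and, for x : Fin 4 → ℝ with η(x,x) = −1, define the energy flux vector s : Fin 4 → ℝ by s 0 = χ·(x 0), s 1 = χ·(x 1), s 2 = −χ·(x 2), s 3 = −χ·(x 3) (i.e. s = −M(x) for the canonical non null electromagnetic energy tensor M = χ·diag(1,−1,1,1)), and let the Poynting vector be s_⊥ := s + η(s,x) • x. Then s_⊥ = 0 if and only if x 2 = 0 and x 3 = 0. -/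
/-- For a non null electromagnetic field with canonical energy tensor
`M = χ · diag(1,-1,1,1)` (`χ > 0`), the energy flux relative to an observer `x` is
`s = -M(x) = (χ x⁰, χ x¹, -χ x², -χ x³)`, and the Poynting vector
`s_⊥ = s + η(s,x) • x` vanishes if and only if `x` lies in the time-like principal
plane, i.e. `x 2 = 0` and `x 3 = 0` (the observers at rest with respect to the field). -/
theorem em_nonnull_observers_at_rest
    (χ : ℝ) (hχ : 0 < χ) (x : Fin 4 → ℝ) (hx : eta x x = -1)
    (s : Fin 4 → ℝ)
    (hs : s = ![χ * x 0, χ * x 1, -(χ * x 2), -(χ * x 3)])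
    (sperp : Fin 4 → ℝ) (hsperp : sperp = s + eta s x • x) :
    sperp = 0 ↔ (x 2 = 0 ∧ x 3 = 0) := by
  have hE : eta s x = -χ * (1 + 2 * (x 2 ^ 2 + x 3 ^ 2)) := by
    simp only [eta, hs, Matrix.cons_val] at hx ⊢
    linear_combination χ * hx
  rw [hsperp, hE, hs]
  constructor
  · intro h
    have h0 := congrFun h 0
    simp only [Pi.add_apply, Pi.smul_apply, smul_eq_mul, Matrix.cons_val_zero,
      Pi.zero_apply] at h0
    have hx0 : x 0 ≠ 0 := by
      intro h0
      simp only [eta, h0] at hx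
      nlinarith [sq_nonneg (x 1), sq_nonneg (x 2), sq_nonneg (x 3)]
    have hr : x 2 ^ 2 + x 3 ^ 2 = 0 := by
      refine mul_left_cancel₀ (mul_ne_zero hχ.ne' hx0) ?_
      linear_combination -h0 / 2
    constructor <;> nlinarith [sq_nonneg (x 2), sq_nonneg (x 3)]
  · rintro ⟨h2, h3⟩
    ext i
    fin_cases i <;> simp [h2, h3]
end

section
/- Let ρ₁, ρ₂, ρ₃ ∈ ℂ with ρ₁ + ρ₂ + ρ₃ = 0. Define p₁ := Re(ρ₂ · conj ρ₃), p₂ := Re(ρ₃ · conj ρ₁), p₃ := Re(ρ₁ · conj ρ₂). Then: (a) Im(ρ₂ · conj ρ₃) = Im(ρ₃ · conj ρ₁) = Im(ρ₁ · conj ρ₂) =: q; (b) ‖ρ₁‖² = −(p₂ + p₃), ‖ρ₂‖² = −(p₃ + p₁), ‖ρ₃‖² = −(p₁ + p₂); (c) q² = p₁p₂ + p₂p₃ + p₃p₁; and consequently (d) p_j + p_k ≤ 0 for all j ≠ k and p₁p₂ + p₂p₃ + p₃p₁ ≥ 0. -/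
open ComplexConjugate

/-- For the Weyl eigenvalues `ρ₁, ρ₂, ρ₃` (with `ρ₁ + ρ₂ + ρ₃ = 0`), the scalars
`pᵢ := Re(ρⱼ · conj ρₖ)` ((ijk) even permutations) satisfy: the imaginary parts of
the `ρⱼ · conj ρₖ` all coincide (`= q`), the real Bel-Robinson eigenvalues are
`tᵢ = ‖ρᵢ‖² = -(pⱼ + pₖ)`, `q² = p₁p₂ + p₂p₃ + p₃p₁`, and consequently
`pⱼ + pₖ ≤ 0` for `j ≠ k` and `p₁p₂ + p₂p₃ + p₃p₁ ≥ 0`. -/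
theorem bel_robinson_eigenvalue_parametrization
    (ρ₁ ρ₂ ρ₃ : ℂ) (h : ρ₁ + ρ₂ + ρ₃ = 0)
    (p₁ p₂ p₃ : ℝ)
    (hp₁ : p₁ = (ρ₂ * conj ρ₃).re)
    (hp₂ : p₂ = (ρ₃ * conj ρ₁).re)
    (hp₃ : p₃ = (ρ₁ * conj ρ₂).re)
    (q : ℝ) (hq : q = (ρ₂ * conj ρ₃).im) :
    ((ρ₃ * conj ρ₁).im = q ∧ (ρ₁ * conj ρ₂).im = q) ∧
    (‖ρ₁‖ ^ 2 = -(p₂ + p₃) ∧ ‖ρ₂‖ ^ 2 = -(p₃ + p₁) ∧ ‖ρ₃‖ ^ 2 = -(p₁ + p₂)) ∧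
    q ^ 2 = p₁ * p₂ + p₂ * p₃ + p₃ * p₁ ∧
    (p₁ + p₂ ≤ 0 ∧ p₂ + p₃ ≤ 0 ∧ p₃ + p₁ ≤ 0) ∧
    0 ≤ p₁ * p₂ + p₂ * p₃ + p₃ * p₁ := by
  obtain ⟨a, b⟩ := ρ₁
  obtain ⟨c, d⟩ := ρ₂
  obtain rfl : ρ₃ = ⟨-(a + c), -(b + d)⟩ := by
    rw [eq_neg_of_add_eq_zero_right h]
    apply Complex.ext <;> simp
  simp only [Complex.mul_re, Complex.mul_im, Complex.conj_re, Complex.conj_im] at hp₁ hp₂ hp₃ hq ⊢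
  simp only [Complex.sq_norm, Complex.normSq_mk]
  have hq2 : q ^ 2 = p₁ * p₂ + p₂ * p₃ + p₃ * p₁ := by
    subst_vars
    ring
  refine ⟨⟨?_, ?_⟩, ⟨?_, ?_, ?_⟩, hq2, ⟨?_, ?_, ?_⟩, hq2 ▸ sq_nonneg q⟩
  iterate 5 subst_vars; ring
  · nlinarith [sq_nonneg (a + c), sq_nonneg (b + d)]
  · nlinarith [sq_nonneg a, sq_nonneg b]
  · nlinarith [sq_nonneg c, sq_nonneg d]
end

section
/- Let u⁰,u¹,u²,u³ ∈ ℝ with (u⁰)² = 1 + (u¹)² + (u²)² + (u³)², and let p₁,p₂,p₃ ∈ ℝ satisfy p_i + p_j ≤ 0 for all i ≠ j and p₁p₂ + p₂p₃ + p₃p₁ ≥ 0. For (i,j,k) an even permutation of (1,2,3) define Aⁱ := (u⁰)²(uⁱ)² − (uʲ)²(uᵏ)², rᵢ := −(4pᵢ + pⱼ + pₖ), and Pⁱ := 4(u⁰)²(uⁱ)² + (uʲ)² + (uᵏ)² + ((uʲ)² − (uᵏ)²)². Then Φ := A¹r₁ + A²r₂ + A³r₃ = −(P¹p₁ + P²p₂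 + P³p₃), and Φ ≥ 0. -/
/-- If `(P + Q - R)² ≤ 4PQ` then the form `P a² + (P + Q - R) a b + Q b²` is nonnegative, and
with `c ≤ 0` and `ab + c(a + b) ≥ 0` this bounds `P a + Q b + R c` from below. -/
theorem weighted_sum_nonneg {P Q R a b c : ℝ} (hP : 0 ≤ P) (hQ : 0 ≤ Q) (hR : 0 ≤ R)
    (hdisc : (P + Q - R) ^ 2 ≤ 4 * (P * Q)) (hc : c ≤ 0) (hac : 0 ≤ a + c) (hbc : 0 ≤ b + c)
    (hq : 0 ≤ a * b + b * c + c * a) : 0 ≤ P * a + Q * b + R * c := by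
  have ha : 0 ≤ a := by linarith
  have hb : 0 ≤ b := by linarith
  have hform : 0 ≤ P * a ^ 2 + (P + Q - R) * (a * b) + Q * b ^ 2 := by
    have h : -(2 * (√P * √Q)) ≤ P + Q - R := by
      have h2 : (2 * (√P * √Q)) ^ 2 = 4 * (P * Q) := by
        rw [mul_pow, mul_pow, Real.sq_sqrt hP, Real.sq_sqrt hQ]; norm_num
      exact (abs_le_of_sq_le_sq' (h2 ▸ hdisc) (by positivity)).1
    have h3 := mul_le_mul_of_nonneg_right h (mul_nonneg ha hb)
    have h4 : (√P * a - √Q * b) ^ 2 = P * a ^ 2 - 2 * (√P * √Q) * (a * b) + Q * b ^ 2 := by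
      rw [sub_sq, mul_pow, mul_pow, Real.sq_sqrt hP, Real.sq_sqrt hQ]; ring
    nlinarith [sq_nonneg (√P * a - √Q * b)]
  rcases (add_nonneg ha hb).eq_or_lt with h0 | hpos
  · obtain rfl : a = 0 := by linarith
    obtain rfl : b = 0 := by linarith
    obtain rfl : c = 0 := by linarith
    simp
  · refine nonneg_of_mul_nonneg_left (b := a + b) ?_ hpos
    nlinarith [mul_nonneg hR hq]


/-- For an observer with components `u⁰,u¹,u²,u³` in the canonical frame
(`(u⁰)² = 1 + (u¹)² + (u²)² + (u³)²`) and scalars `p₁,p₂,p₃` satisfying the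
Bel-Robinson eigenvalue constraints, the quantity `Φ = Σ Aⁱrᵢ` equals
`-(P¹p₁ + P²p₂ + P³p₃)` and is non-negative. -/
theorem bel_robinson_Phi_nonneg
    (u0 u1 u2 u3 p₁ p₂ p₃ : ℝ)
    (hu : u0 ^ 2 = 1 + u1 ^ 2 + u2 ^ 2 + u3 ^ 2)
    (h12 : p₁ + p₂ ≤ 0) (h23 : p₂ + p₃ ≤ 0) (h31 : p₃ + p₁ ≤ 0)
    (hq : 0 ≤ p₁ * p₂ + p₂ * p₃ + p₃ * p₁)
    (A1 A2 A3 r1 r2 r3 P1 P2 P3 Φ : ℝ)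
    (hA1 : A1 = u0 ^ 2 * u1 ^ 2 - u2 ^ 2 * u3 ^ 2)
    (hA2 : A2 = u0 ^ 2 * u2 ^ 2 - u3 ^ 2 * u1 ^ 2)
    (hA3 : A3 = u0 ^ 2 * u3 ^ 2 - u1 ^ 2 * u2 ^ 2)
    (hr1 : r1 = -(4 * p₁ + p₂ + p₃))
    (hr2 : r2 = -(4 * p₂ + p₃ + p₁))
    (hr3 : r3 = -(4 * p₃ + p₁ + p₂))
    (hP1 : P1 = 4 * u0 ^ 2 * u1 ^ 2 + u2 ^ 2 + u3 ^ 2 + (u2 ^ 2 - u3 ^ 2) ^ 2)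
    (hP2 : P2 = 4 * u0 ^ 2 * u2 ^ 2 + u3 ^ 2 + u1 ^ 2 + (u3 ^ 2 - u1 ^ 2) ^ 2)
    (hP3 : P3 = 4 * u0 ^ 2 * u3 ^ 2 + u1 ^ 2 + u2 ^ 2 + (u1 ^ 2 - u2 ^ 2) ^ 2)
    (hΦ : Φ = A1 * r1 + A2 * r2 + A3 * r3) :
    Φ = -(P1 * p₁ + P2 * p₂ + P3 * p₃) ∧ 0 ≤ Φ := by
  have hId : Φ = -(P1 * p₁ + P2 * p₂ + P3 * p₃) := by
    subst hΦ hA1 hA2 hA3 hr1 hr2 hr3 hP1 hP2 hP3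
    rw [hu]; ring
  refine ⟨hId, ?_⟩
  have hP1' : 0 ≤ P1 := by rw [hP1]; positivity
  have hP2' : 0 ≤ P2 := by rw [hP2]; positivity
  have hP3' : 0 ≤ P3 := by rw [hP3]; positivity
  have hdisc : (P1 + P2 - P3) ^ 2 ≤ 4 * (P1 * P2) := by
    have key : 4 * (P1 * P2) - (P1 + P2 - P3) ^ 2 =
        36 * ((u1 ^ 2 * u2 ^ 2 + u2 ^ 2 * u3 ^ 2 + u3 ^ 2 * u1 ^ 2) *
            (1 + u1 ^ 2 + u2 ^ 2 + u3 ^ 2) +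
          u1 ^ 2 * u2 ^ 2 * u3 ^ 2 * (3 + 4 * (u1 ^ 2 + u2 ^ 2 + u3 ^ 2))) := by
      rw [hP1, hP2, hP3, hu]; ring
    refine sub_nonneg.mp (key ▸ ?_)
    positivity

  by_cases h1 : 0 ≤ p₁
  · have := weighted_sum_nonneg (P := P2) (Q := P3) (R := P1) (a := -p₂) (b := -p₃) (c := -p₁)
      hP2' hP3' hP1' (by linarith) (by linarith) (by linarith) (by linarith) (by linarith)
    linarith
  by_cases h2 : 0 ≤ p₂
  · have := weighted_sum_nonneg (P := P3) (Q := P1) (R := P2) (a := -p₃) (b := -p₁) (c := -p₂)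
      hP3' hP1' hP2' (by linarith) (by linarith) (by linarith) (by linarith) (by linarith)
    linarith
  by_cases h3 : 0 ≤ p₃
  · have := weighted_sum_nonneg (P := P1) (Q := P2) (R := P3) (a := -p₁) (b := -p₂) (c := -p₃)
      hP1' hP2' hP3' hdisc (by linarith) (by linarith) (by linarith) (by linarith)
    linarith
  rw [hId]
  nlinarith
end

section
/- Let u⁰,u¹,u²,u³ ∈ ℝ with (u⁰)² = 1 + (u¹)² + (u²)² + (u³)². For (i,j,k) an even permutation of (1,2,3) define Pⁱ := 4(u⁰)²(uⁱ)² + (uʲ)² + (uᵏ)² + ((uʲ)² − (uᵏ)²)². Then P¹·P² − ((P¹ + P² − P³)/2)² = 9·[ (u⁰)²·((u¹u²)² + (u¹u³)² + (u²u³)²) + (4·((u¹)² + (u²)² + (u³)²) + 3)·(u¹u²u³)² ], and in particular this determinant is non-negative. -/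
/-- For an observer with components `u⁰,u¹,u²,u³` in the canonical frame
(`(u⁰)² = 1 + (u¹)² + (u²)² + (u³)²`), the determinant `Δ_P = P¹P² - (P¹²)²`
(with `2P¹² = P¹ + P² - P³`) of the quadratic form `P` has the stated explicit
expression and is non-negative. -/
theorem bel_robinson_DeltaP_identity
    (u0 u1 u2 u3 : ℝ)
    (hu : u0 ^ 2 = 1 + u1 ^ 2 + u2 ^ 2 + u3 ^ 2)
    (P1 P2 P3 : ℝ)
    (hP1 : P1 = 4 * u0 ^ 2 * u1 ^ 2 + u2 ^ 2 + u3 ^ 2 + (u2 ^ 2 - u3 ^ 2) ^ 2)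
    (hP2 : P2 = 4 * u0 ^ 2 * u2 ^ 2 + u3 ^ 2 + u1 ^ 2 + (u3 ^ 2 - u1 ^ 2) ^ 2)
    (hP3 : P3 = 4 * u0 ^ 2 * u3 ^ 2 + u1 ^ 2 + u2 ^ 2 + (u1 ^ 2 - u2 ^ 2) ^ 2) :
    P1 * P2 - ((P1 + P2 - P3) / 2) ^ 2 =
      9 * (u0 ^ 2 * ((u1 * u2) ^ 2 + (u1 * u3) ^ 2 + (u2 * u3) ^ 2) +
        (4 * (u1 ^ 2 + u2 ^ 2 + u3 ^ 2) + 3) * (u1 * u2 * u3) ^ 2) ∧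
    0 ≤ P1 * P2 - ((P1 + P2 - P3) / 2) ^ 2 := by
  have h : P1 * P2 - ((P1 + P2 - P3) / 2) ^ 2 =
      9 * (u0 ^ 2 * ((u1 * u2) ^ 2 + (u1 * u3) ^ 2 + (u2 * u3) ^ 2) +
        (4 * (u1 ^ 2 + u2 ^ 2 + u3 ^ 2) + 3) * (u1 * u2 * u3) ^ 2) := by
    rw [hP1, hP2, hP3, hu]
    ring
  refine ⟨h, ?_⟩
  rw [h]
  positivity
end

section
/- Let u⁰,u¹,u²,u³ ∈ ℝ with (u⁰)² = 1 + (u¹)² + (u²)² + (u³)². For (i,j,k) an even permutation of (1,2,3) define Pⁱ := 4(u⁰)²(uⁱ)² + (uʲ)² + (uᵏ)² + ((uʲ)² − (uᵏ)²)². Then for all real p₁, p₂: P¹·p₁² + P²·p₂² + (P¹ + P² − P³)·p₁·p₂ ≥ 0. -/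
/-- For an observer with components `u⁰,u¹,u²,u³` in the canonical frame
(`(u⁰)² = 1 + (u¹)² + (u²)² + (u³)²`), the quadratic form
`P = P^{AB} p_A p_B` (with `P^{11} = P¹`, `P^{22} = P²`, `2P^{12} = P¹ + P² - P³`)
is non-negative. -/
theorem bel_robinson_P_quadratic_form_nonneg
    (u0 u1 u2 u3 : ℝ)
    (hu : u0 ^ 2 = 1 + u1 ^ 2 + u2 ^ 2 + u3 ^ 2)
    (P1 P2 P3 : ℝ)
    (hP1 : P1 = 4 * u0 ^ 2 * u1 ^ 2 + u2 ^ 2 + u3 ^ 2 + (u2 ^ 2 - u3 ^ 2) ^ 2)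
    (hP2 : P2 = 4 * u0 ^ 2 * u2 ^ 2 + u3 ^ 2 + u1 ^ 2 + (u3 ^ 2 - u1 ^ 2) ^ 2)
    (hP3 : P3 = 4 * u0 ^ 2 * u3 ^ 2 + u1 ^ 2 + u2 ^ 2 + (u1 ^ 2 - u2 ^ 2) ^ 2) :
    ∀ p₁ p₂ : ℝ, 0 ≤ P1 * p₁ ^ 2 + P2 * p₂ ^ 2 + (P1 + P2 - P3) * p₁ * p₂ := by
  intro p q
  have hac : 0 ≤ u1 ^ 2 * u3 ^ 2 := by positivity
  have hbc : 0 ≤ u2 ^ 2 * u3 ^ 2 := by positivity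
  have hlin : 0 ≤ u1 ^ 2 * (2 * p + q) ^ 2 + u2 ^ 2 * (p + 2 * q) ^ 2 + u3 ^ 2 * (p - q) ^ 2 := by
    positivity
  rw [hP1, hP2, hP3, hu]
  rcases le_total ((p + 2 * q) * (p - q)) 0 with h | h
  · linarith [sq_nonneg (u1 ^ 2 * (2 * p + q) + u2 ^ 2 * (p + 2 * q) + u3 ^ 2 * (p - q)),
      mul_nonneg hbc (neg_nonneg.mpr h)]
  · have hXZ : 0 ≤ (2 * p + q) * (p - q) := by nlinarith [sq_nonneg (p - q)]
    linarith [sq_nonneg (u1 ^ 2 * (2 * p + q) + u2 ^ 2 * (p + 2 * q) - u3 ^ 2 * (p - q)),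
      mul_nonneg hac hXZ]
end

section
/- Let u⁰,u¹,u²,u³ ∈ ℝ with (u⁰)² = 1 + (u¹)² + (u²)² + (u³)², and let p₁,p₂,p₃,q ∈ ℝ satisfy p_i + p_j ≤ 0 for all i ≠ j and q² = p₁p₂ + p₂p₃ + p₃p₁. For (i,j,k) an even permutation of (1,2,3) define Aⁱ := (u⁰)²(uⁱ)² − (uʲ)²(uᵏ)², rᵢ := −(4pᵢ + pⱼ + pₖ), A := u⁰u¹u²u³, and Φ := A¹r₁ + A²r₂ + A³r₃. Then R := Φ² − 36·q²·A² ≥ 0. -/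
/-- Reverse Cauchy-Schwarz inequality for the Lorentzian quadratic form
`2 (ab + bc + ca) - (a² + b² + c²)` and its dual form `xy + yz + zx`. -/
theorem lorentzian_reverse_cauchy_schwarz (a b c x y z : ℝ)
    (hD : 0 ≤ 2 * (a * b + b * c + c * a) - (a ^ 2 + b ^ 2 + c ^ 2)) :
    (2 * (a * b + b * c + c * a) - (a ^ 2 + b ^ 2 + c ^ 2)) * (x * y + y * z + z * x) ≤
      (x * a + y * b + z * c) ^ 2 := by
  set D := 2 * (a * b + b * c + c * a) - (a ^ 2 + b ^ 2 + c ^ 2) with hDdef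
  rcases eq_or_ne a 0 with rfl | ha
  · have hD0 : D = 0 := le_antisymm (by nlinarith [sq_nonneg (b - c)]) hD
    rw [hD0, zero_mul]
    positivity
  · have key : a ^ 2 * ((x * a + y * b + z * c) ^ 2 - D * (x * y + y * z + z * x)) =
        (a ^ 2 * x + (a * b - D / 2) * y + (a * c - D / 2) * z) ^ 2 +
          D / 4 * ((a + b - c) * y - (a + c - b) * z) ^ 2 := by
      rw [hDdef]
      ring
    have hnonneg : 0 ≤ a ^ 2 * ((x * a + y * b + z * c) ^ 2 - D * (x * y + y * z + z * x)) := by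
      rw [key]
      positivity
    exact sub_nonneg.mp (nonneg_of_mul_nonneg_right hnonneg (by positivity))

/-- If `w ≥ x + y + z` for non-negative `x, y, z`, then `w x y z` is bounded by the second
elementary symmetric polynomial of `w x - y z`, `w y - z x`, `w z - x y`. -/
theorem mul_le_esymm_two_of_add_le {w x y z : ℝ} (hx : 0 ≤ x) (hy : 0 ≤ y) (hz : 0 ≤ z)
    (hw : x + y + z ≤ w) :
    w * x * y * z ≤ (w * x - y * z) * (w * y - z * x) + (w * y - z * x) * (w * z - x * y) +
      (w * z - x * y) * (w * x - y * z) := by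
  have hw0 : 0 ≤ w := by linarith
  have hgap : 0 ≤ w - (x + y + z) := sub_nonneg.mpr hw
  have hsum : 0 ≤ w * (x * y + y * z + z * x) * (w - (x + y + z)) + 2 * (w * x * y * z) +
      (x + y + z) * (x * y * z) := by positivity
  linarith

/-- For an observer with components `u⁰,u¹,u²,u³` in the canonical frame
(`(u⁰)² = 1 + (u¹)² + (u²)² + (u³)²`) and Bel-Robinson eigenvalue scalars
`p₁,p₂,p₃,q` (with `pᵢ + pⱼ ≤ 0` for `i ≠ j` and `q² = p₁p₂ + p₂p₃ + p₃p₁`),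
the quantity `R = Φ² - (6qA)²` is non-negative. -/
theorem bel_robinson_R_nonneg
    (u0 u1 u2 u3 p₁ p₂ p₃ q : ℝ)
    (hu : u0 ^ 2 = 1 + u1 ^ 2 + u2 ^ 2 + u3 ^ 2)
    (h12 : p₁ + p₂ ≤ 0) (h23 : p₂ + p₃ ≤ 0) (h31 : p₃ + p₁ ≤ 0)
    (hq : q ^ 2 = p₁ * p₂ + p₂ * p₃ + p₃ * p₁)
    (A1 A2 A3 r1 r2 r3 A Φ R : ℝ)
    (hA1 : A1 = u0 ^ 2 * u1 ^ 2 - u2 ^ 2 * u3 ^ 2)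
    (hA2 : A2 = u0 ^ 2 * u2 ^ 2 - u3 ^ 2 * u1 ^ 2)
    (hA3 : A3 = u0 ^ 2 * u3 ^ 2 - u1 ^ 2 * u2 ^ 2)
    (hr1 : r1 = -(4 * p₁ + p₂ + p₃))
    (hr2 : r2 = -(4 * p₂ + p₃ + p₁))
    (hr3 : r3 = -(4 * p₃ + p₁ + p₂))
    (hA : A = u0 * u1 * u2 * u3)
    (hΦ : Φ = A1 * r1 + A2 * r2 + A3 * r3)
    (hR : R = Φ ^ 2 - 36 * q ^ 2 * A ^ 2) :
    0 ≤ R := by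
  have hD : 36 * q ^ 2 =
      2 * (r1 * r2 + r2 * r3 + r3 * r1) - (r1 ^ 2 + r2 ^ 2 + r3 ^ 2) := by
    rw [hq, hr1, hr2, hr3]
    ring
  have hcs := lorentzian_reverse_cauchy_schwarz r1 r2 r3 A1 A2 A3 (hD ▸ by positivity)
  rw [← hD, ← hΦ] at hcs
  have hA_le : A ^ 2 ≤ A1 * A2 + A2 * A3 + A3 * A1 := by
    have h := mul_le_esymm_two_of_add_le (sq_nonneg u1) (sq_nonneg u2) (sq_nonneg u3)
      (show u1 ^ 2 + u2 ^ 2 + u3 ^ 2 ≤ u0 ^ 2 by linarith)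
    rw [← hA1, ← hA2, ← hA3] at h
    calc A ^ 2 = u0 ^ 2 * u1 ^ 2 * u2 ^ 2 * u3 ^ 2 := by rw [hA]; ring
      _ ≤ _ := h
  have hmul := mul_le_mul_of_nonneg_left hA_le (show 0 ≤ 36 * q ^ 2 by positivity)
  rw [hR]
  linarith
end

section
/- Let p₁,p₂,p₃,q ∈ ℝ satisfy p_i + p_j ≤ 0 for all i ≠ j and q² = p₁p₂ + p₂p₃ + p₃p₁, and set ξ := −(p₁ + p₂ + p₃)/2. For every u⁰,u¹,u²,u³ ∈ ℝ with (u⁰)² = 1 + (u¹)² + (u²)² + (u³)², defining Aⁱ := (u⁰)²(uⁱ)² − (uʲ)²(uᵏ)², rᵢ := −(4pᵢ + pⱼ + pₖ) ((i,j,k) even permutations of (1,2,3)), A := u⁰u¹u²u³, and the relative super-energy density τ(u) := ξ + (A¹r₁ + A²r₂ + A³r₃) + 6qA, one has τ(u) ≥ ξ; moreover, for the rest observer (u⁰,u¹,u²,u³) = (1,0,0,0) one has τ = ξ. Hence ξ is the minimum value of the relative super-energy density, attained by the observer at rest. -/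
/-- Scaled form of the reverse Cauchy-Schwarz inequality for the Lorentzian quadratic form
`x₁x₂ + x₂x₃ + x₃x₁`: its polarization is nonnegative on the future cone, and the square of the
polarization dominates the product of the two values. -/
theorem reverse_cauchy_schwarz_esymm_two {x₁ x₂ x₃ y₁ y₂ y₃ : ℝ}
    (hx : 0 ≤ x₁ + x₂ + x₃) (hy : 0 ≤ y₁ + y₂ + y₃)
    (hx' : 0 ≤ x₁ * x₂ + x₂ * x₃ + x₃ * x₁) (hy' : 0 ≤ y₁ * y₂ + y₂ * y₃ + y₃ * y₁) :
    0 ≤ x₁ * (y₂ + y₃) + x₂ * (y₃ + y₁) + x₃ * (y₁ + y₂) ∧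
    4 * ((x₁ * x₂ + x₂ * x₃ + x₃ * x₁) * (y₁ * y₂ + y₂ * y₃ + y₃ * y₁)) ≤
      (x₁ * (y₂ + y₃) + x₂ * (y₃ + y₁) + x₃ * (y₁ + y₂)) ^ 2 := by
  have eq_zero : ∀ z₁ z₂ z₃ : ℝ, z₁ + z₂ + z₃ = 0 → 0 ≤ z₁ * z₂ + z₂ * z₃ + z₃ * z₁ →
      z₁ = 0 ∧ z₂ = 0 ∧ z₃ = 0 := by
    intro z₁ z₂ z₃ h h'
    have hsq : z₁ ^ 2 + z₂ ^ 2 + z₃ ^ 2 + 2 * (z₁ * z₂ + z₂ * z₃ + z₃ * z₁) = 0 := by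
      linear_combination (z₁ + z₂ + z₃) * h
    refine ⟨?_, ?_, ?_⟩ <;> refine pow_eq_zero_iff two_ne_zero |>.1 ?_ <;>
      linarith [sq_nonneg z₁, sq_nonneg z₂, sq_nonneg z₃]
  rcases hx.eq_or_lt with hx0 | hx0
  · obtain ⟨rfl, rfl, rfl⟩ := eq_zero _ _ _ hx0.symm hx'
    simp
  rcases hy.eq_or_lt with hy0 | hy0
  · obtain ⟨rfl, rfl, rfl⟩ := eq_zero _ _ _ hy0.symm hy'
    simp
  set B := x₁ * (y₂ + y₃) + x₂ * (y₃ + y₁) + x₃ * (y₁ + y₂) with hB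
  set X := x₁ + x₂ + x₃ with hX
  set Y := y₁ + y₂ + y₃ with hY
  set E := x₁ * x₂ + x₂ * x₃ + x₃ * x₁ with hE
  set F := y₁ * y₂ + y₂ * y₃ + y₃ * y₁ with hF
  have hXY : 0 < X * Y := mul_pos hx0 hy0
  have key : X ^ 2 * F + Y ^ 2 * E ≤ X * Y * B := by
    have h : 2 * (X * Y * B - (X ^ 2 * F + Y ^ 2 * E)) =
        (X * y₁ - Y * x₁) ^ 2 + (X * y₂ - Y * x₂) ^ 2 + (X * y₃ - Y * x₃) ^ 2 := by
      rw [hB, hX, hY, hE, hF]; ring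
    linarith [sq_nonneg (X * y₁ - Y * x₁), sq_nonneg (X * y₂ - Y * x₂),
      sq_nonneg (X * y₃ - Y * x₃)]
  have hsum : 0 ≤ X ^ 2 * F + Y ^ 2 * E := by positivity
  refine ⟨nonneg_of_mul_nonneg_right (hsum.trans key) hXY, ?_⟩
  have hsq : (X * Y) ^ 2 * (4 * (E * F)) ≤ (X * Y) ^ 2 * B ^ 2 := by
    have h := pow_le_pow_left₀ hsum key 2
    linarith [sq_nonneg (X ^ 2 * F - Y ^ 2 * E)]
  exact le_of_mul_le_mul_left hsq (by positivity)

/-- In the canonical frame of a non radiative (type I or D) gravitational field,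
with Bel-Robinson eigenvalue scalars `p₁,p₂,p₃,q` and proper super-energy density
`ξ = -(p₁+p₂+p₃)/2`, the relative super-energy density
`τ(u) = ξ + Σ Aⁱrᵢ + 6qA` of any observer satisfies `τ(u) ≥ ξ`, and the observer
at rest `(1,0,0,0)` measures exactly `ξ`: the minimum of the relative super-energy
density is the proper super-energy density, attained by the observers at rest. -/
theorem proper_superenergy_is_minimum
    (p₁ p₂ p₃ q ξ : ℝ)
    (h12 : p₁ + p₂ ≤ 0) (h23 : p₂ + p₃ ≤ 0) (h31 : p₃ + p₁ ≤ 0)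
    (hq : q ^ 2 = p₁ * p₂ + p₂ * p₃ + p₃ * p₁)
    (hξ : ξ = -(p₁ + p₂ + p₃) / 2)
    (τ : ℝ → ℝ → ℝ → ℝ → ℝ)
    (hτ : ∀ u0 u1 u2 u3 : ℝ, τ u0 u1 u2 u3 =
      ξ + ((u0 ^ 2 * u1 ^ 2 - u2 ^ 2 * u3 ^ 2) * (-(4 * p₁ + p₂ + p₃))
         + (u0 ^ 2 * u2 ^ 2 - u3 ^ 2 * u1 ^ 2) * (-(4 * p₂ + p₃ + p₁))
         + (u0 ^ 2 * u3 ^ 2 - u1 ^ 2 * u2 ^ 2) * (-(4 * p₃ + p₁ + p₂)))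
        + 6 * q * (u0 * u1 * u2 * u3)) :
    (∀ u0 u1 u2 u3 : ℝ, u0 ^ 2 = 1 + u1 ^ 2 + u2 ^ 2 + u3 ^ 2 →
      ξ ≤ τ u0 u1 u2 u3) ∧
    τ 1 0 0 0 = ξ := by
  refine ⟨fun u0 u1 u2 u3 hu => ?_, by rw [hτ]; ring⟩
  rw [hτ]
  set X := u0 ^ 2 with hX
  set a := u1 ^ 2 with ha
  set b := u2 ^ 2 with hb
  set c := u3 ^ 2 with hc
  have ha0 : 0 ≤ a := sq_nonneg u1
  have hb0 : 0 ≤ b := sq_nonneg u2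
  have hc0 : 0 ≤ c := sq_nonneg u3
  have hX0 : 0 ≤ X := sq_nonneg u0
  set α := X * a - b * c with hα
  set β := X * b - c * a with hβ
  set γ := X * c - a * b with hγ
  have hσ : 0 ≤ α + β + γ := by
    have h : α + β + γ = a + b + c + (a ^ 2 + b ^ 2 + c ^ 2) + (a * b + b * c + c * a) := by
      rw [hα, hβ, hγ, hu]; ring
    rw [h]; positivity
  have he : X * (a * b * c) ≤ α * β + β * γ + γ * α := by
    have h : α * β + β * γ + γ * α - X * (a * b * c) =
        X * (a * b + b * c + c * a) + 2 * X * (a * b * c) + a * b * c * (a + b + c) := by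
      rw [hα, hβ, hγ, hu]; ring
    have h' : 0 ≤ X * (a * b + b * c + c * a) + 2 * X * (a * b * c) +
        a * b * c * (a + b + c) := by positivity
    linarith
  have he0 : 0 ≤ α * β + β * γ + γ * α := le_trans (by positivity) he
  obtain ⟨h0, hsq⟩ := reverse_cauchy_schwarz_esymm_two
    (x₁ := -p₁) (x₂ := -p₂) (x₃ := -p₃)
    (y₁ := 2 * β + 2 * γ - α) (y₂ := 2 * γ + 2 * α - β) (y₃ := 2 * α + 2 * β - γ)
    (by linarith) (by linarith) (by linarith [sq_nonneg q]) (by linarith)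
  have hΦ : -p₁ * (2 * γ + 2 * α - β + (2 * α + 2 * β - γ)) +
      -p₂ * (2 * α + 2 * β - γ + (2 * β + 2 * γ - α)) +
      -p₃ * (2 * β + 2 * γ - α + (2 * γ + 2 * α - β)) =
      α * (-(4 * p₁ + p₂ + p₃)) + β * (-(4 * p₂ + p₃ + p₁)) + γ * (-(4 * p₃ + p₁ + p₂)) := by
    ring
  rw [hΦ] at h0 hsq
  have hA : (6 * q * (u0 * u1 * u2 * u3)) ^ 2 ≤
      (α * (-(4 * p₁ + p₂ + p₃)) + β * (-(4 * p₂ + p₃ + p₁)) +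
        γ * (-(4 * p₃ + p₁ + p₂))) ^ 2 := by
    calc (6 * q * (u0 * u1 * u2 * u3)) ^ 2 = 36 * (q ^ 2 * (X * (a * b * c))) := by
          rw [hX, ha, hb, hc]; ring
      _ ≤ 36 * (q ^ 2 * (α * β + β * γ + γ * α)) := by gcongr
      _ ≤ _ := by
          refine le_trans (le_of_eq ?_) hsq
          rw [hq]; ring
  linarith [(abs_le_of_sq_le_sq' hA h0).1]
end

section
/- Let u, e : Fin 4 → ℝ with η(u,u) = −1, η(e,e) = 1, η(u,e) = 0, let c > 0, and set ℓ := c • (u + e). For φ ∈ ℝ let ũ(φ) := Real.cosh φ • u + Real.sinh φ • e. Then the super-energy density of the type N Bel-Robinson tensor T = ℓ ⊗ ℓ ⊗ ℓ ⊗ ℓ relative to ũ(φ) is T(ũ(φ),ũ(φ),ũ(φ),ũ(φ)) = (η(ℓ,ũ(φ)))⁴ = c⁴·Real.exp (−4φ) = T(u,u,u,u)·Real.exp (−4φ); in particular it tends to 0 as φ → +∞ and to +∞ as φ → −∞. -/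
/-- The component of `c • (u + e)` along the boosted observer is redshifted by `e^{-φ}`. -/
theorem eta_smul_add_boost {u e : Fin 4 → ℝ} (hu : eta u u = -1) (he : eta e e = 1)
    (hue : eta u e = 0) (c φ : ℝ) :
    eta (c • (u + e)) (Real.cosh φ • u + Real.sinh φ • e) = -(c * Real.exp (-φ)) := by
  rw [← Real.cosh_sub_sinh]
  simp only [eta, Pi.add_apply, Pi.smul_apply, smul_eq_mul] at *
  linear_combination c * Real.cosh φ * hu + c * Real.sinh φ * he +
    c * (Real.cosh φ + Real.sinh φ) * hue

/-- For a type N gravitational field with Bel-Robinson tensor `T = ℓ⊗ℓ⊗ℓ⊗ℓ`,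
`ℓ = c(u + e)`, the super-energy density relative to the boosted observers
`ũ(φ) = cosh φ • u + sinh φ • e` is `(η(ℓ,ũ(φ)))⁴ = c⁴ e^{-4φ} = T(u,u,u,u) e^{-4φ}`;
it tends to `0` as `φ → +∞` and to `+∞` as `φ → -∞`. -/
theorem typeN_boosted_superenergy_density
    (u e : Fin 4 → ℝ) (hu : eta u u = -1) (he : eta e e = 1) (hue : eta u e = 0)
    (c : ℝ) (hc : 0 < c)
    (ℓ : Fin 4 → ℝ) (hℓ : ℓ = c • (u + e))
    (ut : ℝ → Fin 4 → ℝ)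
    (hut : ∀ φ, ut φ = Real.cosh φ • u + Real.sinh φ • e) :
    (∀ φ, (eta ℓ (ut φ)) ^ 4 = c ^ 4 * Real.exp (-4 * φ) ∧
      (eta ℓ (ut φ)) ^ 4 = (eta ℓ u) ^ 4 * Real.exp (-4 * φ)) ∧
    Filter.Tendsto (fun φ => (eta ℓ (ut φ)) ^ 4) Filter.atTop (nhds 0) ∧
    Filter.Tendsto (fun φ => (eta ℓ (ut φ)) ^ 4) Filter.atBot Filter.atTop := by
  have density (φ : ℝ) : (eta ℓ (ut φ)) ^ 4 = c ^ 4 * Real.exp (-4 * φ) := by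
    have hexp : Real.exp (-4 * φ) = Real.exp (-φ) ^ 4 := by
      rw [← Real.exp_nat_mul]
      congr 1
      push_cast
      ring
    rw [hut, hℓ, eta_smul_add_boost hu he hue, hexp]
    ring
  have rest : (eta ℓ u) ^ 4 = c ^ 4 := by
    simpa [hut] using density 0
  have hc4 : 0 < c ^ 4 := pow_pos hc 4
  refine ⟨fun φ => ⟨density φ, by rw [density, rest]⟩, ?_, ?_⟩
  · simp only [density]
    have h : Filter.Tendsto (fun φ : ℝ => -4 * φ) Filter.atTop Filter.atBot :=
      Filter.tendsto_id.const_mul_atTop_of_neg (by norm_num)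
    simpa using (Real.tendsto_exp_atBot.comp h).const_mul (c ^ 4)
  · simp only [density]
    have h : Filter.Tendsto (fun φ : ℝ => -4 * φ) Filter.atBot Filter.atTop :=
      Filter.tendsto_id.const_mul_atBot_of_neg (by norm_num)
    exact (Real.tendsto_exp_atTop.comp h).const_mul_atTop hc4
end
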